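/- arXiv:1605.03512 — 2 statements merged into one kernel-verified Lean document; each statement's English description precedes it below -/
import Mathlib

section
/- Define the one-step transition matrix P_m(v,w) := binom(w,v)/((2m+2)(2m+1)) for v ∈ W_m, w ∈ W_{m+1}. Then for all m, n ∈ ℕ, v ∈ W_m and w ∈ W_{m+n}, the n-step transition probability, i.e. the sum over all chains v = v_0, v_1 ∈ W_{m+1}, …, v_n = w of the product ∏_{k=0}^{n-1} P_{m+k}(v_k, v_{k+1}), equals binom(w,v) · n!·n! / ((2m+1)(2m+2)⋯(2m+2n)). -/
open MeasureTheory ProbabilityTheory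

/-- `W n`: words over `{a,b}` (with `true` playing the role of the letter `a` and
`false` the letter `b`) of length `2n` with exactly `n` letters `a`
(and hence `n` letters `b`). -/
def IsWord (n : ℕ) (w : Fin (2*n) → Bool) : Prop :=
  (Finset.univ.filter fun i => w i = true).card = n

instance (n : ℕ) : DecidablePred (IsWord n) := fun w =>
  decidable_of_iff ((Finset.univ.filter fun i => w i = true).card = n) Iff.rfl

/-- `subwordCount w v` = number of occurrences of `v` as a subword of `w`:
the number of strictly increasing maps `f` from the index set of `v` to the
index set of `w` such that the letter of `w` at `f k` is the letter of `v` at `k`. -/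
noncomputable def subwordCount {q p : ℕ} (w : Fin q → Bool) (v : Fin p → Bool) : ℕ :=
  Nat.card {f : Fin p → Fin q // StrictMono f ∧ ∀ k, w (f k) = v k}

/-- One-step transition probability of the growing word chain:
`P_m(v,w) = binom(w,v)/((2m+2)(2m+1))` for `v ∈ W_m`, `w ∈ W_{m+1}`. -/
noncomputable def oneStep (m : ℕ) (v : Fin (2*m) → Bool) (w : Fin (2*(m+1)) → Bool) : ℝ :=
  subwordCount w v / ((2*m+2)*(2*m+1))

/-- `n`-step transition probability of the growing word chain from `v ∈ W_m` to
`w ∈ W_{m+n}`: the sum over all chains of intermediate words of the products of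
one-step transition probabilities. -/
noncomputable def nStep (m : ℕ) : (n : ℕ) → (Fin (2*m) → Bool) → (Fin (2*(m+n)) → Bool) → ℝ
  | 0, v, w => if v = w then 1 else 0
  | n+1, v, w =>
      ∑ v' ∈ Finset.univ.filter (IsWord (m+n)),
        nStep m n v v' * oneStep (m+n) v' w

/-- Occurrences of `v` in `w`, as a finset of maps. -/
def occurrences {q p : ℕ} (w : Fin q → Bool) (v : Fin p → Bool) : Finset (Fin p → Fin q) :=
  Finset.univ.filter fun f => StrictMono f ∧ ∀ k, w (f k) = v k

theorem subwordCount_eq_card_occurrences {q p : ℕ} (w : Fin q → Bool) (v : Fin p → Bool) :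
    subwordCount w v = (occurrences w v).card := by
  rw [subwordCount, Nat.card_eq_fintype_card, Fintype.card_subtype, occurrences]

theorem subwordCount_same_length {p : ℕ} (w v : Fin p → Bool) :
    subwordCount w v = if v = w then 1 else 0 := by
  have hid : ∀ f : Fin p → Fin p, StrictMono f ↔ f = id := fun f =>
    ⟨fun hf => StrictMono.range_inj hf strictMono_id |>.1 (by
      rw [Set.range_id, (Finite.injective_iff_surjective.1 hf.injective).range_eq]),
      fun hf => hf ▸ strictMono_id⟩
  rw [subwordCount_eq_card_occurrences, occurrences]
  simp_rw [hid]
  split_ifs with h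
  · subst h
    rw [Finset.card_eq_one]
    refine ⟨id, ?_⟩
    ext f
    simp only [Finset.mem_filter, Finset.mem_univ, true_and, Finset.mem_singleton]
    exact ⟨fun hf => hf.1, fun hf => ⟨hf, fun k => by simp [hf]⟩⟩
  · rw [Finset.card_eq_zero, Finset.filter_eq_empty_iff]
    rintro f - ⟨rfl, hf⟩
    exact h (funext fun k => (hf k).symm)

/-- Strictly monotone maps out of `Fin p` correspond to `p`-element subsets. -/
theorem card_strictMono_filter_image {q p : ℕ} (P : Finset (Fin q) → Prop) [DecidablePred P] :
    (Finset.univ.filter fun f : Fin p → Fin q =>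
        StrictMono f ∧ P (Finset.univ.image f)).card
      = (Finset.univ.filter fun T : Finset (Fin q) => T.card = p ∧ P T).card := by
  refine Finset.card_bij (fun f _ => Finset.univ.image f) ?_ ?_ ?_
  · intro f hf
    simp only [Finset.mem_filter, Finset.mem_univ, true_and] at hf ⊢
    exact ⟨by rw [Finset.card_image_of_injective _ hf.1.injective, Finset.card_fin], hf.2⟩
  · intro f hf g hg h
    simp only [Finset.mem_filter, Finset.mem_univ, true_and] at hf hg
    refine (StrictMono.range_inj hf.1 hg.1).1 ?_
    simpa using congrArg (fun T : Finset (Fin q) => (T : Set (Fin q))) h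
  · intro T hT
    simp only [Finset.mem_filter, Finset.mem_univ, true_and] at hT
    have himg : Finset.univ.image (T.orderEmbOfFin hT.1) = T := by
      apply Finset.coe_injective
      simp
    refine ⟨T.orderEmbOfFin hT.1, ?_, himg⟩
    simp only [Finset.mem_filter, Finset.mem_univ, true_and]
    exact ⟨(T.orderEmbOfFin hT.1).strictMono, by rw [himg]; exact hT.2⟩

/-- A superset of `S` missing exactly one element of `A` and one of `Aᶜ` amounts to a choice of
those two elements. -/
theorem card_supersets_missing_pair {α : Type*} [Fintype α] [DecidableEq α] (A S : Finset α)
    (N : ℕ) (hA : A.card = N + 1) (hA' : Aᶜ.card = N + 1) :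
    (Finset.univ.filter fun T : Finset α =>
        T.card = 2 * N ∧ ((T ∩ A).card = N ∧ S ⊆ T)).card
      = (A \ S).card * (Aᶜ \ S).card := by
  rw [← Finset.card_product]
  symm
  refine Finset.card_bij (fun x _ => ({x.1, x.2} : Finset α)ᶜ) ?_ ?_ ?_
  · rintro ⟨i, j⟩ h
    simp only [Finset.mem_product, Finset.mem_sdiff, Finset.mem_compl] at h
    obtain ⟨⟨hi, hiS⟩, hj, hjS⟩ := h
    have hij : i ≠ j := fun e => hj (e ▸ hi)
    simp only [Finset.mem_filter, Finset.mem_univ, true_and]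
    refine ⟨?_, ?_, ?_⟩
    · have h1 := Finset.card_add_card_compl A
      rw [Finset.card_compl, Finset.card_pair hij]
      omega
    · have : ({i, j} : Finset α)ᶜ ∩ A = A.erase i := by
        ext x
        simp only [Finset.mem_inter, Finset.mem_compl, Finset.mem_insert, Finset.mem_singleton,
          Finset.mem_erase]
        grind
      rw [this, Finset.card_erase_of_mem hi, hA, Nat.add_sub_cancel]
    · intro x hx
      simp only [Finset.mem_compl, Finset.mem_insert, Finset.mem_singleton]
      grind
  · rintro ⟨i, j⟩ h ⟨i', j'⟩ h' e
    simp only [Finset.mem_product, Finset.mem_sdiff, Finset.mem_compl] at h h'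
    have e' : ({i, j} : Finset α) = {i', j'} := compl_injective e
    have h1 : i ∈ ({i', j'} : Finset α) := e' ▸ (by simp)
    have h2 : j ∈ ({i', j'} : Finset α) := e' ▸ (by simp)
    simp only [Finset.mem_insert, Finset.mem_singleton] at h1 h2
    grind
  · intro T hT
    simp only [Finset.mem_filter, Finset.mem_univ, true_and] at hT
    obtain ⟨hc, hTA, hST⟩ := hT
    have h1 : (A \ T).card = 1 := by
      have := Finset.card_sdiff_add_card_inter A T
      rw [Finset.inter_comm] at this
      omega
    have h2 : (Aᶜ \ T).card = 1 := by
      have := Finset.card_sdiff_add_card_inter Aᶜ T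
      have h3 := Finset.card_sdiff_add_card_inter T A
      have h4 : T \ A = Aᶜ ∩ T := by
        ext x
        simp [and_comm]
      rw [h4] at h3
      omega
    obtain ⟨i, hi⟩ := Finset.card_eq_one.1 h1
    obtain ⟨j, hj⟩ := Finset.card_eq_one.1 h2
    simp only [Finset.ext_iff, Finset.mem_sdiff, Finset.mem_singleton, Finset.mem_compl] at hi hj
    refine ⟨(i, j), ?_, ?_⟩
    · simp only [Finset.mem_product, Finset.mem_sdiff, Finset.mem_compl]
      have := (hi i).2 rfl
      have := (hj j).2 rfl
      grind
    · ext x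
      simp only [Finset.mem_compl, Finset.mem_insert, Finset.mem_singleton]
      have := hi x
      have := hj x
      grind

/-- Occurrences of `v` in the subword of `w` selected by `f` are the occurrences of `v` in `w`
which factor through `f`. -/
theorem card_occurrences_comp {r q p : ℕ} (w : Fin r → Bool) (v : Fin p → Bool)
    {f : Fin q → Fin r} (hf : StrictMono f) :
    (occurrences (w ∘ f) v).card
      = ((occurrences w v).filter fun h =>
          Finset.univ.image h ⊆ Finset.univ.image f).card := by
  refine Finset.card_bij (fun g _ => f ∘ g) ?_ ?_ ?_
  · intro g hg
    simp only [occurrences, Finset.mem_filter, Finset.mem_univ, true_and] at hg ⊢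
    refine ⟨⟨hf.comp hg.1, hg.2⟩, ?_⟩
    rw [← Finset.image_image]
    exact Finset.image_subset_image (Finset.subset_univ _)
  · intro g _ g' _ h
    exact hf.injective.comp_left h
  · intro h hh
    simp only [occurrences, Finset.mem_filter, Finset.mem_univ, true_and] at hh
    obtain ⟨⟨hm, hv⟩, hsub⟩ := hh
    have : ∀ k, ∃ l, f l = h k := fun k => by
      simpa using hsub (Finset.mem_image_of_mem h (Finset.mem_univ k))
    choose g hg using this
    refine ⟨g, ?_, funext hg⟩
    simp only [occurrences, Finset.mem_filter, Finset.mem_univ, true_and]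
    refine ⟨fun a b hab => hf.lt_iff_lt.1 (by rw [hg, hg]; exact hm hab), fun k => ?_⟩
    rw [Function.comp_apply, hg, hv]

theorem isWord_comp_iff {r N : ℕ} (w : Fin r → Bool) {f : Fin (2 * N) → Fin r}
    (hf : Function.Injective f) :
    IsWord N (w ∘ f) ↔
      (Finset.univ.image f ∩ Finset.univ.filter fun i => w i = true).card = N := by
  have : Finset.univ.image f ∩ (Finset.univ.filter fun i => w i = true)
      = (Finset.univ.filter fun i => (w ∘ f) i = true).image f := by
    ext x
    simp only [Finset.mem_inter, Finset.mem_image, Finset.mem_filter, Finset.mem_univ, true_and,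
      Function.comp_apply]
    grind
  rw [this, Finset.card_image_of_injective _ hf, IsWord]

/-- An occurrence of `v ∈ W_m` in `w ∈ W_{m+n+1}` extends in `(n+1)²` ways to an occurrence of
some word in `W_{m+n}`. -/
theorem card_extensions (m n : ℕ) (v : Fin (2 * m) → Bool) (w : Fin (2 * (m + n + 1)) → Bool)
    (hv : IsWord m v) (hw : IsWord (m + n + 1) w) {h : Fin (2 * m) → Fin (2 * (m + n + 1))}
    (hh : h ∈ occurrences w v) :
    (Finset.univ.filter fun f : Fin (2 * (m + n)) → Fin (2 * (m + n + 1)) =>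
        (StrictMono f ∧ IsWord (m + n) (w ∘ f)) ∧
          Finset.univ.image h ⊆ Finset.univ.image f).card = (n + 1) ^ 2 := by
  simp only [occurrences, Finset.mem_filter, Finset.mem_univ, true_and] at hh
  obtain ⟨hm, hval⟩ := hh
  set A : Finset (Fin (2 * (m + n + 1))) := Finset.univ.filter fun i => w i = true
  have hA : A.card = m + n + 1 := hw
  have hA' : Aᶜ.card = m + n + 1 := by
    rw [Finset.card_compl, hA, Fintype.card_fin]
    omega
  have hS : (Finset.univ.image h ∩ A).card = m :=
    (isWord_comp_iff w hm.injective).1 (by rwa [show w ∘ h = v from funext hval])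
  have hScard : (Finset.univ.image h).card = 2 * m := by
    rw [Finset.card_image_of_injective _ hm.injective, Finset.card_fin]
  have h1 : (A \ Finset.univ.image h).card = n + 1 := by
    have := Finset.card_sdiff_add_card_inter A (Finset.univ.image h)
    rw [Finset.inter_comm] at this
    omega
  have h2 : (Aᶜ \ Finset.univ.image h).card = n + 1 := by
    have := Finset.card_sdiff_add_card_inter Aᶜ (Finset.univ.image h)
    have h3 := Finset.card_sdiff_add_card_inter (Finset.univ.image h) A
    have h4 : Finset.univ.image h \ A = Aᶜ ∩ Finset.univ.image h := by
      rw [Finset.sdiff_eq_inter_compl, Finset.inter_comm]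
    rw [h4] at h3
    omega
  have key := card_supersets_missing_pair A (Finset.univ.image h) (m + n) hA hA'
  rw [h1, h2, ← pow_two, ← card_strictMono_filter_image] at key
  rw [← key]
  congr 1
  refine Finset.filter_congr fun f _ => ?_
  rw [and_assoc]
  refine and_congr_right fun hf => ?_
  rw [isWord_comp_iff w hf.injective]

theorem sum_subwordCount_mul_subwordCount (m n : ℕ) (v : Fin (2 * m) → Bool)
    (w : Fin (2 * (m + n + 1)) → Bool) (hv : IsWord m v) (hw : IsWord (m + n + 1) w) :
    ∑ v' ∈ Finset.univ.filter (IsWord (m + n)), subwordCount v' v * subwordCount w v'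
      = (n + 1) ^ 2 * subwordCount w v := by
  simp_rw [subwordCount_eq_card_occurrences]
  set F := Finset.univ.filter fun f : Fin (2 * (m + n)) → Fin (2 * (m + n + 1)) =>
    StrictMono f ∧ IsWord (m + n) (w ∘ f)
  calc ∑ v' ∈ Finset.univ.filter (IsWord (m + n)),
        (occurrences v' v).card * (occurrences w v').card
      = ∑ v' ∈ Finset.univ.filter (IsWord (m + n)),
          ∑ f ∈ F with w ∘ f = v', (occurrences (w ∘ f) v).card := by
        refine Finset.sum_congr rfl fun v' hv' => ?_
        have hset : (F.filter fun f => w ∘ f = v') = occurrences w v' := by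
          ext f
          simp only [F, occurrences, Finset.mem_filter, Finset.mem_univ, true_and, funext_iff,
            Function.comp_apply] at hv' ⊢
          constructor
          · exact fun h => ⟨h.1.1, h.2⟩
          · exact fun h => ⟨⟨h.1, by rwa [show w ∘ f = v' from funext h.2]⟩, h.2⟩
        rw [Finset.sum_congr rfl fun f hf => by rw [(Finset.mem_filter.1 hf).2],
          Finset.sum_const, hset, smul_eq_mul, mul_comm]
    _ = ∑ f ∈ F, (occurrences (w ∘ f) v).card :=
        Finset.sum_fiberwise_of_maps_to (fun f hf => by
          simp only [F, Finset.mem_filter, Finset.mem_univ, true_and] at hf ⊢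
          exact hf.2) _
    _ = ∑ f ∈ F, ((occurrences w v).filter fun h =>
          Finset.univ.image h ⊆ Finset.univ.image f).card :=
        Finset.sum_congr rfl fun f hf =>
          card_occurrences_comp w v (Finset.mem_filter.1 hf).2.1
    _ = ∑ h ∈ occurrences w v, (F.filter fun f =>
          Finset.univ.image h ⊆ Finset.univ.image f).card :=
        (Finset.sum_card_bipartiteAbove_eq_sum_card_bipartiteBelow
          fun h f => Finset.univ.image h ⊆ Finset.univ.image f).symm
    _ = ∑ h ∈ occurrences w v, (n + 1) ^ 2 :=
        Finset.sum_congr rfl fun h hh => by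
          rw [Finset.filter_filter]
          exact card_extensions m n v w hv hw hh
    _ = (n + 1) ^ 2 * (occurrences w v).card := by
        rw [Finset.sum_const, smul_eq_mul, mul_comm]

/-- For words `v ∈ W_m` and `w ∈ W_{m+n}`, the `n`-step transition probability equals
`binom(w,v) · n!·n! / ((2m+1)(2m+2)⋯(2m+2n))`. -/
theorem nStep_eq (m n : ℕ) (v : Fin (2*m) → Bool) (w : Fin (2*(m+n)) → Bool)
    (hv : IsWord m v) (hw : IsWord (m+n) w) :
    nStep m n v w
      = (subwordCount w v : ℝ) * (n.factorial * n.factorial)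
          / ∏ k ∈ Finset.range (2*n), (2*m + k + 1 : ℝ) := by
  induction n with
  | zero =>
    rw [subwordCount_same_length]
    simp [nStep]
  | succ n ih =>
    have hsum := sum_subwordCount_mul_subwordCount m n v w hv hw
    have hsum' : ∑ v' ∈ Finset.univ.filter (IsWord (m + n)),
        (subwordCount v' v : ℝ) * (subwordCount w v' : ℝ)
          = ((n : ℝ) + 1) ^ 2 * subwordCount w v := by
      exact_mod_cast hsum
    have hpos : ∏ k ∈ Finset.range (2 * n), (2 * m + k + 1 : ℝ) ≠ 0 :=
      Finset.prod_ne_zero_iff.2 fun k _ => by positivity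
    have h1 : (2 * m + 2 * n + 1 : ℝ) ≠ 0 := by positivity
    have h2 : (2 * m + 2 * n + 2 : ℝ) ≠ 0 := by positivity
    set D := ∏ k ∈ Finset.range (2 * n), (2 * m + k + 1 : ℝ) with hD
    calc nStep m (n + 1) v w
        = ∑ v' ∈ Finset.univ.filter (IsWord (m + n)),
            (subwordCount v' v : ℝ) * (subwordCount w v' : ℝ) *
              (n.factorial * n.factorial /
                (D * ((2 * m + 2 * n + 1) * (2 * m + 2 * n + 2)))) := by
          rw [nStep]
          refine Finset.sum_congr rfl fun v' hv' => ?_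
          rw [ih v' (Finset.mem_filter.1 hv').2, oneStep]
          push_cast
          rw [show (2 * ((m : ℝ) + n) + 2) * (2 * (m + n) + 1)
            = (2 * m + 2 * n + 1) * (2 * m + 2 * n + 2) by ring, div_mul_div_comm]
          ring
      _ = _ := by
          rw [← Finset.sum_mul, hsum', show 2 * (n + 1) = 2 * n + 1 + 1 by ring,
            Finset.prod_range_succ, Finset.prod_range_succ, ← hD, Nat.factorial_succ]
          push_cast
          rw [show (2 * m + (2 * n + 1) + 1 : ℝ) = 2 * m + 2 * n + 2 by ring, mul_div_assoc']
          congr 1 <;> ring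
end

section
/- For every n ∈ ℕ and every w ∈ W_n, the n-step transition probability from the empty word to w (the sum over all chains ∅ = v_0, v_1 ∈ W_1, …, v_n = w of ∏_{k=0}^{n-1} P_k(v_k, v_{k+1}), where P_m(v,w) = binom(w,v)/((2m+2)(2m+1))) equals n!·n!/(2n)!. In particular, the chain at time n is uniformly distributed over W_n. -/
open MeasureTheory ProbabilityTheory

/-- The empty word. -/
def emptyWord : Fin (2*0) → Bool := ![]

/-- The strictly increasing maps selecting a word of `W m` out of a word `w` of `W (m + 1)`
correspond to the pairs formed by a letter `a` and a letter `b` of `w` to be removed. -/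
theorem card_strictMono_isWord_comp (m : ℕ) (w : Fin (2 * (m + 1)) → Bool)
    (hw : IsWord (m + 1) w) :
    {f : Fin (2 * m) → Fin (2 * (m + 1)) | StrictMono f ∧ IsWord m (w ∘ f)}.ncard
      = (m + 1) ^ 2 := by
  classical
  set A : Finset (Fin (2 * (m + 1))) := Finset.univ.filter fun i => w i = true with hA
  have cA : A.card = m + 1 := hw
  have cB : Aᶜ.card = m + 1 := by rw [Finset.card_compl, cA, Fintype.card_fin]; omega
  have key : ∀ f : Fin (2 * m) → Fin (2 * (m + 1)), StrictMono f →
      (IsWord m (w ∘ f) ↔ ((Finset.univ.image f) ∩ A).card = m) := by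
    intro f hf
    have h : Finset.univ.image f ∩ A
        = (Finset.univ.filter fun i => (w ∘ f) i = true).image f := by
      ext x
      simp only [hA, Finset.mem_inter, Finset.mem_image, Finset.mem_filter, Finset.mem_univ,
        true_and, Function.comp]
      grind
    rw [h, Finset.card_image_of_injective _ hf.injective, IsWord]
  have ne : ∀ p ∈ A ×ˢ Aᶜ, p.1 ≠ p.2 := by
    intro p h e
    simp only [Finset.mem_product, Finset.mem_compl] at h
    exact h.2 (e ▸ h.1)
  have cS : ∀ p ∈ A ×ˢ Aᶜ, (({p.1, p.2} : Finset (Fin (2 * (m + 1))))ᶜ).card = 2 * m := by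
    intro p hp
    rw [Finset.card_compl, Finset.card_pair (ne p hp), Fintype.card_fin]
    omega
  rw [Set.ncard_eq_toFinset_card']
  have hc : (A ×ˢ Aᶜ).card = (m + 1) ^ 2 := by rw [Finset.card_product, cA, cB, sq]
  rw [← hc]
  symm
  refine Finset.card_bij (fun p hp => ⇑(Finset.orderEmbOfFin _ (cS p hp))) ?_ ?_ ?_
  · intro p hp
    have hmono := (Finset.orderEmbOfFin _ (cS p hp)).strictMono
    simp only [Set.mem_toFinset, Set.mem_ofPred_eq]
    refine ⟨hmono, (key _ hmono).2 ?_⟩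
    rw [Finset.image_orderEmbOfFin_univ]
    have hE : ({p.1, p.2} : Finset (Fin (2 * (m + 1))))ᶜ ∩ A = A.erase p.1 := by
      simp only [Finset.mem_product, Finset.mem_compl] at hp
      ext x
      simp only [Finset.mem_inter, Finset.mem_compl, Finset.mem_insert, Finset.mem_singleton,
        Finset.mem_erase]
      grind
    rw [hE, Finset.card_erase_of_mem (Finset.mem_product.1 hp).1, cA]
    rfl
  · intro p hp q hq h
    have h' := congrArg (fun f => Finset.univ.image f) h
    simp only [Finset.image_orderEmbOfFin_univ] at h'
    have h2 := compl_injective h'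
    simp only [Finset.mem_product, Finset.mem_compl] at hp hq
    have e1 : p.1 ∈ ({q.1, q.2} : Finset _) := by rw [← h2]; simp
    have e2 : p.2 ∈ ({q.1, q.2} : Finset _) := by rw [← h2]; simp
    simp only [Finset.mem_insert, Finset.mem_singleton] at e1 e2
    ext1 <;> grind
  · intro f hf
    simp only [Set.mem_toFinset, Set.mem_ofPred_eq] at hf
    obtain ⟨hmono, hword⟩ := hf
    rw [key f hmono] at hword
    set S := Finset.univ.image f with hS
    have cSf : S.card = 2 * m := by
      rw [hS, Finset.card_image_of_injective _ hmono.injective, Finset.card_univ,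
        Fintype.card_fin]
    have hAS : (A \ S).card = 1 := by
      have := Finset.card_inter_add_card_sdiff A S
      rw [Finset.inter_comm] at this
      omega
    have hBS : (Aᶜ \ S).card = 1 := by
      have h1 := Finset.card_inter_add_card_sdiff S A
      have h2 := Finset.card_inter_add_card_sdiff Aᶜ S
      have h3 : Aᶜ ∩ S = S \ A := by ext; simp [and_comm]
      rw [h3] at h2
      omega
    obtain ⟨a, ha⟩ := Finset.card_eq_one.1 hAS
    obtain ⟨b, hb⟩ := Finset.card_eq_one.1 hBS
    have ha' : a ∈ A \ S := by simp [ha]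
    have hb' : b ∈ Aᶜ \ S := by simp [hb]
    have hab : (a, b) ∈ A ×ˢ Aᶜ :=
      Finset.mem_product.2 ⟨(Finset.mem_sdiff.1 ha').1, (Finset.mem_sdiff.1 hb').1⟩
    refine ⟨(a, b), hab, (Finset.orderEmbOfFin_unique _ (fun i => ?_) hmono).symm⟩
    have hi : f i ∈ S := Finset.mem_image_of_mem f (Finset.mem_univ i)
    simp only [Finset.mem_compl, Finset.mem_insert, Finset.mem_singleton, not_or]
    exact ⟨fun h => (Finset.mem_sdiff.1 ha').2 (h ▸ hi),
      fun h => (Finset.mem_sdiff.1 hb').2 (h ▸ hi)⟩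

/-- A word of `W (m + 1)` has `(m + 1) ^ 2` occurrences of words of `W m` in total. -/
theorem sum_subwordCount (m : ℕ) (w : Fin (2 * (m + 1)) → Bool) (hw : IsWord (m + 1) w) :
    ∑ v ∈ Finset.univ.filter (IsWord m), subwordCount w v = (m + 1) ^ 2 := by
  classical
  rw [← card_strictMono_isWord_comp m w hw, Set.ncard_eq_toFinset_card',
    Finset.card_eq_sum_card_fiberwise (f := fun f => w ∘ f)
      (t := Finset.univ.filter (IsWord m))]
  · refine Finset.sum_congr rfl fun v hv => ?_
    rw [subwordCount, Nat.card_eq_fintype_card, Fintype.card_subtype]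
    congr 1
    ext f
    simp only [Finset.mem_filter, Finset.mem_univ, true_and, Set.mem_toFinset,
      Set.mem_ofPred_eq] at hv ⊢
    constructor
    · rintro ⟨h1, h2⟩
      have h3 : w ∘ f = v := funext h2
      exact ⟨⟨h1, h3 ▸ hv⟩, h3⟩
    · rintro ⟨⟨h1, -⟩, h3⟩
      exact ⟨h1, congrFun h3⟩
  · intro f hf
    simpa using (Set.mem_toFinset.1 hf).2

/-- The `n`-step transition probability from the empty word to `w ∈ W_n` equals
`n!·n!/(2n)!`; in particular the growing word chain at time `n` is uniformly
distributed over `W_n`. -/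
theorem nStep_from_empty (n : ℕ) (w : Fin (2*(0+n)) → Bool) (hw : IsWord (0+n) w) :
    nStep 0 n emptyWord w = (n.factorial * n.factorial : ℝ) / (2*n).factorial := by
  induction n with
  | zero =>
    have h : emptyWord = w := funext fun i => i.elim0
    simp [nStep, h]
  | succ n ih =>
    have hsum := congrArg (Nat.cast (R := ℝ)) (sum_subwordCount (0 + n) w hw)
    push_cast at hsum
    have hf : ((2 * (n + 1)).factorial : ℝ)
        = (2 * n + 2) * (2 * n + 1) * ((2 * n).factorial : ℝ) := by
      rw [show 2 * (n + 1) = 2 * n + 1 + 1 by ring, Nat.factorial_succ, Nat.factorial_succ]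
      push_cast
      ring
    have hstep : nStep 0 (n + 1) emptyWord w
        = ∑ v ∈ Finset.univ.filter (IsWord (0 + n)),
          (n.factorial * n.factorial : ℝ) / (2 * n).factorial * oneStep (0 + n) v w := by
      rw [nStep]
      exact Finset.sum_congr rfl fun v hv => by rw [ih v (Finset.mem_filter.1 hv).2]
    rw [hstep, ← Finset.mul_sum]
    simp only [oneStep]
    rw [← Finset.sum_div]
    erw [hsum]
    rw [hf, Nat.factorial_succ]
    have h0 : ((2 * n).factorial : ℝ) ≠ 0 := by positivity
    push_cast
    field_simp
    ring
end
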